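/- Surplus demand (Proposition 3). Let i ∈ F and let S ⊆ C_i^r be a subset of customers with ∑_{j ∈ S} q(j) ≤ Q(i). Then for every feasible CSCP-r solution (x, Y) there exists a feasible CSCP-r solution (x', Y) with the same open set Y (hence the same objective value) such that: whenever i ∈ Y and no customer j ∈ C_i^r \ S satisfies (i,j) ∈ x', then (i,k) ∈ x' for every k ∈ S. -/

import Mathlib

open Finset

/-- The coverage set `C_i^r` of facility `i` for radius `r`. -/
noncomputable def coverSet {F C : Type*} [Fintype C]
    (d : F → C → ℝ) (q : C → ℕ) (Q : F → ℕ) (r : ℝ) (i : F) : Finset C :=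
  Finset.univ.filter (fun j => d i j ≤ r ∧ q j ≤ Q i)

/-- Feasibility of a CSCP-r solution `(x, Y)`. -/
def CSCPFeasible {F C : Type*} [Fintype C] [DecidableEq F] [DecidableEq C]
    (d : F → C → ℝ) (q : C → ℕ) (Q : F → ℕ) (r : ℝ)
    (x : Finset (F × C)) (Y : Finset F) : Prop :=
  (∀ j : C, ∃ i : F, (i, j) ∈ x) ∧
  (∀ i : F, ∀ j : C, (i, j) ∈ x → j ∈ coverSet d q Q r i ∧ i ∈ Y) ∧
  (∀ i : F, ∑ j ∈ Finset.univ.filter (fun j => (i, j) ∈ x), q j ≤ Q i)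

/-- **Surplus demand (Proposition 3).** -/
theorem surplus_demand {F C : Type*} [Fintype F] [Fintype C]
    [DecidableEq F] [DecidableEq C]
    (d : F → C → ℝ) (q : C → ℕ) (Q : F → ℕ) (r : ℝ) (i : F)
    (S : Finset C) (hS : S ⊆ coverSet d q Q r i)
    (hScap : ∑ j ∈ S, q j ≤ Q i)
    (x : Finset (F × C)) (Y : Finset F)
    (hfeas : CSCPFeasible d q Q r x Y) :
    ∃ x' : Finset (F × C),
      CSCPFeasible d q Q r x' Y ∧
      (i ∈ Y → (∀ j ∈ coverSet d q Q r i \ S, (i, j) ∉ x') →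
        ∀ k ∈ S, (i, k) ∈ x') := by
  by_cases h : i ∈ Y ∧ ∀ j ∈ coverSet d q Q r i \ S, (i, j) ∉ x
  · obtain ⟨hiY, hS'⟩ := h
    obtain ⟨hcover, hassign, hcap⟩ := hfeas
    -- Serve all of `S` from `i`, which serves only customers in `S` under `x`.
    have hxS : ∀ j, (i, j) ∈ x → j ∈ S := fun j hj => by
      by_contra hjS
      exact hS' j (mem_sdiff.2 ⟨(hassign i j hj).1, hjS⟩) hj
    have hmem : ∀ i' j, (i', j) ∈ x ∪ {i} ×ˢ S ↔ (i', j) ∈ x ∨ i' = i ∧ j ∈ S := by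
      simp [and_comm, eq_comm]
    refine ⟨x ∪ {i} ×ˢ S, ⟨fun j => ?_, fun i' j hj => ?_, fun i' => ?_⟩,
      fun _ _ k hk => (hmem i k).2 (Or.inr ⟨rfl, hk⟩)⟩
    · obtain ⟨i', hi'⟩ := hcover j
      exact ⟨i', mem_union_left _ hi'⟩
    · rcases (hmem i' j).1 hj with hx | ⟨rfl, hjS⟩
      · exact hassign i' j hx
      · exact ⟨hS hjS, hiY⟩
    · by_cases hi : i' = i
      · subst hi
        refine (sum_le_sum_of_subset fun j hj => ?_).trans hScap
        rcases (hmem i' j).1 (mem_filter.1 hj).2 with hj | ⟨_, hj⟩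
        · exact hxS j hj
        · exact hj
      · refine (sum_le_sum_of_subset fun j hj => ?_).trans (hcap i')
        rcases (hmem i' j).1 (mem_filter.1 hj).2 with hj | ⟨hj, _⟩
        · exact mem_filter.2 ⟨mem_univ j, hj⟩
        · exact absurd hj hi
  · exact ⟨x, hfeas, fun hiY hS' => absurd ⟨hiY, hS'⟩ h⟩
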